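/- Let (T,d,ρ,u) be a plane ℝ-tree and let p be a Borel probability measure on T. If A is a random variable with values in T×[0,1] and law p_L, then the real random variable p_↶(A) is uniformly distributed on [0,1]. -/

import Mathlib

open Set MeasureTheory Filter Metric

/-- The metric segment `[[x,y]]` between `x` and `y`. -/
def geoSeg {T : Type*} [MetricSpace T] (x y : T) : Set T :=
  {z | dist x z + dist z y = dist x y}

/-- `(T,d)` is an `ℝ`-tree: it is geodesic (any two points are joined by a geodesic
segment, which is `geoSeg x y`) and loopless (this segment is the unique arc joining
`x` and `y`). -/
structure IsRTree (T : Type*) [MetricSpace T] : Prop where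
  geodesic : ∀ x y : T, ∃ γ : ℝ → T, γ 0 = x ∧ γ (dist x y) = y ∧
    (∀ s ∈ Icc (0:ℝ) (dist x y), ∀ t ∈ Icc (0:ℝ) (dist x y),
      dist (γ s) (γ t) = |s - t|) ∧
    γ '' Icc (0:ℝ) (dist x y) = geoSeg x y
  loopless : ∀ x y : T, ∀ f : ℝ → T, ContinuousOn f (Icc (0:ℝ) 1) →
    InjOn f (Icc (0:ℝ) 1) → f 0 = x → f 1 = y → f '' Icc (0:ℝ) 1 = geoSeg x y

/-- The set of connected components of `T \ {x}`. -/
def comps {T : Type*} [MetricSpace T] (x : T) : Set (Set T) :=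
  {C | ∃ y, y ≠ x ∧ C = connectedComponentIn ({x}ᶜ) y}

/-- A plane `ℝ`-tree structure on the metric space `T`: `T` is a separable complete
`ℝ`-tree with a root and a balanced angle function `u`.  `cca x y` is the closest
common ancestor of `x` and `y`. -/
structure PlaneRTree (T : Type*) [MetricSpace T] where
  sep : TopologicalSpace.SeparableSpace T
  cpl : CompleteSpace T
  tree : IsRTree T
  root : T
  cca : T → T → T
  cca_mem : ∀ x y : T, cca x y ∈ geoSeg root x ∩ geoSeg root y
  cca_max : ∀ x y : T, ∀ z ∈ geoSeg root x ∩ geoSeg root y,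
    dist root z ≤ dist root (cca x y)
  u : T → T → ℝ
  u_mem : ∀ x y : T, u x y ∈ Icc (0:ℝ) 1
  u_root : ∀ x : T, u x root = 0
  u_self : ∀ x : T, u x x = 0
  u_eq_iff : ∀ x y z : T, y ≠ x → z ≠ x →
    (u x y = u x z ↔ connectedComponentIn ({x}ᶜ) y = connectedComponentIn ({x}ᶜ) z)
  balanced : ∀ x y : T, (comps x).ncard = 2 → u x y = 0 ∨ u x y = 1/2

namespace PlaneRTree

variable {T : Type*} [MetricSpace T]

open Classical in
/-- The angle `u(x, (y,w))`: it is `u x y` if `x ≠ y`, and `w` if `x = y`. -/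
noncomputable def ang (P : PlaneRTree T) (x : T) (β : T × ℝ) : ℝ :=
  if x = β.1 then β.2 else P.u x β.1

/-- `α ↷ β` : `α` is at the left of `β`. -/
def leftOf (P : PlaneRTree T) (α β : T × ℝ) : Prop :=
  P.ang (P.cca α.1 β.1) α < P.ang (P.cca α.1 β.1) β

/-- `α → β` : `β` is in front of `α`. -/
def frontOf (P : PlaneRTree T) (α β : T × ℝ) : Prop :=
  α.1 ∈ geoSeg P.root β.1 ∧ P.ang α.1 β = α.2

/-- The contour relation `≺` : `α ≺ β` iff `α ↷ β` or `α → β`. -/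
def precOf (P : PlaneRTree T) (α β : T × ℝ) : Prop :=
  P.leftOf α β ∨ P.frontOf α β

end PlaneRTree

namespace PlaneRTree

variable {T : Type*} [MetricSpace T] [MeasurableSpace T] [BorelSpace T]

/-- The measure `p_L`, product of `p` with Lebesgue measure on `[0,1]`. -/
noncomputable def pL (p : Measure T) : Measure (T × ℝ) :=
  p.prod (volume.restrict (Icc (0:ℝ) 1))

/-- `p_↶(α) = p_L {β : β ↷ α}`, the mass at the left of `α`. -/
noncomputable def pleft (P : PlaneRTree T) (p : Measure T) (α : T × ℝ) : ℝ :=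
  (pL p {β : T × ℝ | P.leftOf β α}).toReal

/-- `p_→(α) = p_L {β : α → β}`, the mass in front of `α`. -/
noncomputable def pfront (P : PlaneRTree T) (p : Measure T) (α : T × ℝ) : ℝ :=
  (pL p {β : T × ℝ | P.frontOf α β}).toReal

/-- `p_↷(α) = p_L {β : α ↷ β}`, the mass at the right of `α`. -/
noncomputable def pright (P : PlaneRTree T) (p : Measure T) (α : T × ℝ) : ℝ :=
  (pL p {β : T × ℝ | P.leftOf α β}).toReal

end PlaneRTree

/-- A probability measure on `ℝ` carried by `[0,1]`, without atoms, which is almost everywhere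
equal to its own distribution function is the uniform law. -/
theorem eq_uniform_of_ae_Iic_eq_self (ν : Measure ℝ) [IsProbabilityMeasure ν]
    [NullSingletonClass ν] (h01 : ∀ᵐ t ∂ν, t ∈ Icc (0:ℝ) 1) (hν : ∀ᵐ t ∂ν, ν.real (Iic t) = t) :
    ν = volume.restrict (Icc (0:ℝ) 1) := by
  set Φ : ℝ → ℝ := fun t => ν.real (Iic t) with hΦ
  have hdiff : ∀ a b, a ≤ b → Φ b = Φ a + ν.real (Ioo a b) := by
    intro a b hab
    have h1 : ν.real (Ioc a b) = ν.real (Ioo a b) := measureReal_congr Ioo_ae_eq_Ioc.symm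
    rw [← h1, hΦ]
    simp only
    rw [← measureReal_union (by grind) measurableSet_Ioc,
      Iic_union_Ioc_eq_Iic hab]
  have h0 : Φ 0 = 0 := by
    have : Iic (0:ℝ) =ᵐ[ν] Iio 0 := Iio_ae_eq_Iic.symm
    rw [hΦ]
    simp only
    rw [measureReal_congr this, measureReal_def, ENNReal.toReal_eq_zero_iff]
    left
    refine measure_mono_null ?_ (ae_iff.1 h01)
    intro x hx
    simp only [mem_Iio] at hx
    simp [hx]
  have h1 : Φ 1 = 1 := by
    rw [hΦ]
    simp only
    have : ν (Iic 1) = 1 := by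
      refine (prob_compl_eq_zero_iff measurableSet_Iic).1 (measure_mono_null ?_ (ae_iff.1 h01))
      exact fun x hx h => hx h.2
    simp [measureReal_def, this]
  have hcont : Continuous Φ := by
    have : Φ = ProbabilityTheory.cdf ν := by
      ext t; rw [ProbabilityTheory.cdf_eq_real]
    rw [this, continuous_iff_continuousAt]
    intro t
    rw [(ProbabilityTheory.cdf ν).mono.continuousAt_iff_leftLim_eq_rightLim,
      (ProbabilityTheory.cdf ν).rightLim_eq]
    have hs := (ProbabilityTheory.cdf ν).measure_singleton t
    rw [ProbabilityTheory.measure_cdf, measure_singleton, eq_comm, ENNReal.ofReal_eq_zero] at hs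
    have := (ProbabilityTheory.cdf ν).mono.leftLim_le (le_refl t)
    linarith
  have hK : IsClosed {t | Φ t = t} := isClosed_eq hcont continuous_id
  have hall : ∀ s ∈ Icc (0:ℝ) 1, Φ s = s := by
    rintro s ⟨hs0, hs1⟩
    have hbdd : BddAbove ({t | Φ t = t} ∩ Iic s) := ⟨s, fun x hx => hx.2⟩
    have hbdd' : BddBelow ({t | Φ t = t} ∩ Ici s) := ⟨s, fun x hx => hx.2⟩
    have ha := (hK.inter isClosed_Iic).csSup_mem ⟨0, h0, hs0⟩ hbdd
    have hb := (hK.inter isClosed_Ici).csInf_mem ⟨1, h1, hs1⟩ hbdd'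
    set a := sSup ({t | Φ t = t} ∩ Iic s)
    set b := sInf ({t | Φ t = t} ∩ Ici s)
    have hnull : ν.real (Ioo a b) = 0 := by
      rw [measureReal_def, ENNReal.toReal_eq_zero_iff]
      left
      refine measure_mono_null ?_ (ae_iff.1 hν)
      rintro x ⟨hx1, hx2⟩ hx
      rcases le_total x s with h | h
      · exact absurd (le_csSup hbdd ⟨hx, h⟩) (not_le.2 hx1)
      · exact absurd (csInf_le hbdd' ⟨hx, h⟩) (not_le.2 hx2)
    have hab := hdiff a b (ha.2.trans hb.2)
    have e1 : Φ a = a := ha.1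
    have e2 : Φ b = b := hb.1
    have h3 : a ≤ s := ha.2
    have h4 : s ≤ b := hb.2
    have : s = a := by linarith
    rw [this]; exact e1
  refine Measure.ext_of_Iic _ _ fun s => ?_
  rw [Measure.restrict_apply measurableSet_Iic]
  have hmono : ∀ a b, a ≤ b → Φ a ≤ Φ b := fun a b h => by
    rw [hdiff a b h]; linarith [measureReal_nonneg (μ := ν) (s := Ioo a b)]
  have key : ν (Iic s) = ENNReal.ofReal (Φ s) := by simp [hΦ, measureReal_def]
  rw [key]
  rcases lt_or_ge s 0 with h | h
  · have e1 : Φ s = 0 := le_antisymm (h0 ▸ hmono _ _ h.le) measureReal_nonneg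
    have : Iic s ∩ Icc 0 1 = ∅ := by ext x; simp; intros; linarith
    simp [e1, this]
  rcases le_or_gt s 1 with h' | h'
  · have : Iic s ∩ Icc 0 1 = Icc 0 s := by ext x; simp; grind
    simp [this, hall s ⟨h, h'⟩]
  · have e1 : Φ s = 1 := le_antisymm measureReal_le_one (h1 ▸ hmono _ _ h'.le)
    have : Iic s ∩ Icc 0 1 = Icc 0 1 := by ext x; simp; grind
    simp [e1, this]

section RandomOrder

variable {S : Type*} [MeasurableSpace S] {m : Measure S} [IsProbabilityMeasure m]
  {r : S → S → Prop}

theorem exists_measure_rel_ne_zero (hr : MeasurableSet {q : S × S | r q.1 q.2})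
    (hae : ∀ᵐ q ∂(m.prod m), r q.1 q.2 ∨ r q.2 q.1) {E : Set S} (hE : MeasurableSet E)
    (hE0 : m E ≠ 0) : ∃ y ∈ E, m {z | z ∈ E ∧ r z y} ≠ 0 := by
  by_contra! hcon
  set D : Set (S × S) := {q | (q.1 ∈ E ∧ q.2 ∈ E) ∧ r q.2 q.1} with hD
  have hswap : MeasurableSet {q : S × S | r q.2 q.1} := measurable_swap hr
  have hDm : MeasurableSet D := (hE.prod hE).inter hswap
  have hD0 : m.prod m D = 0 := by
    rw [Measure.measure_prod_null hDm]
    refine Eventually.of_forall fun y => ?_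
    by_cases hy : y ∈ E
    · refine measure_mono_null ?_ (hcon y hy)
      exact fun z hz => ⟨hz.1.2, hz.2⟩
    · have : Prod.mk y ⁻¹' D = ∅ := by
        ext z; simp [hD, hy]
      simp [this]
  have hD0' : m.prod m (Prod.swap ⁻¹' D) = 0 :=
    (Measure.measurePreserving_swap (μ := m) (ν := m)).measure_preimage
      hDm.nullMeasurableSet |>.trans hD0
  have : m.prod m (E ×ˢ E) = 0 := by
    refine measure_mono_null (t := D ∪ Prod.swap ⁻¹' D ∪ {q | ¬ (r q.1 q.2 ∨ r q.2 q.1)}) ?_ (measure_union_null (measure_union_null hD0 hD0') (ae_iff.1 hae))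
    rintro ⟨x, y⟩ ⟨hx, hy⟩
    simp only [hD, mem_union, mem_ofPred_eq, mem_preimage, Prod.swap] at *
    tauto
  rw [Measure.prod_prod] at this
  simp [hE0] at this

/-- If a measurable strict partial order compares almost surely two independent points of law `m`,
then the mass below a point of law `m` is uniform on `[0,1]`. -/
theorem map_measureReal_below_eq_uniform (hr : MeasurableSet {q : S × S | r q.1 q.2})
    (htrans : ∀ x y z, r x y → r y z → r x z) (hasymm : ∀ x y, r x y → ¬ r y x)
    (hae : ∀ᵐ q ∂(m.prod m), r q.1 q.2 ∨ r q.2 q.1) :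
    Measurable (fun x => m.real {y | r y x}) ∧
      Measure.map (fun x => m.real {y | r y x}) m = volume.restrict (Icc (0:ℝ) 1) := by
  set G : S → ℝ := fun x => m.real {y | r y x}
  have hG : Measurable G := (measurable_measure_prodMk_right hr).ennreal_toReal
  refine ⟨hG, ?_⟩
  have hswap : MeasurableSet {q : S × S | r q.2 q.1} := measurable_swap hr
  have hbelow : ∀ x, MeasurableSet {y | r y x} := fun x => measurable_prodMk_right hr
  have habove : ∀ x, MeasurableSet {y | r x y} := fun x => measurable_prodMk_left hr
  have hmono : ∀ x y, r x y → G x ≤ G y := fun x y hxy =>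
    measureReal_mono (fun z hz => htrans z x y hz hxy)
  have hatom : ∀ t, m (G ⁻¹' {t}) = 0 := by
    intro t
    by_contra hE0
    obtain ⟨y, hy, hy0⟩ :=
      exists_measure_rel_ne_zero hr hae (hG (measurableSet_singleton t)) hE0
    obtain ⟨x, hx, hx0⟩ := exists_measure_rel_ne_zero (r := fun a b => r b a) hswap
      (hae.mono fun q hq => hq.symm) ((hG (measurableSet_singleton t)).inter (hbelow y)) hy0
    have hsub : G x + m.real {z | r x z ∧ r z y} ≤ G y := by
      have hdisj : Disjoint {z | r z x} {z | r x z ∧ r z y} :=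
        Set.disjoint_left.2 fun z hz hz' => hasymm _ _ hz hz'.1
      refine (measureReal_union hdisj ((habove x).inter (hbelow y))).symm.trans_le ?_
      refine measureReal_mono ?_
      rintro z (hz | hz)
      · exact htrans z x y hz hx.2
      · exact hz.2
    have hpos : 0 < m.real {z | r x z ∧ r z y} := by
      rw [measureReal_def, ENNReal.toReal_pos_iff]
      refine ⟨pos_iff_ne_zero.2 fun h => hx0 (measure_mono_null ?_ h), measure_lt_top _ _⟩
      rintro z ⟨hz, hz'⟩
      exact ⟨hz', hz.2⟩
    have e1 : G x = t := hx.1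
    have e2 : G y = t := hy
    linarith
  have := Measure.isProbabilityMeasure_map (μ := m) hG.aemeasurable
  have : NullSingletonClass (m.map G) :=
    ⟨fun t => by rw [Measure.map_apply hG (measurableSet_singleton t), hatom t]⟩
  refine eq_uniform_of_ae_Iic_eq_self _ ?_ ?_
  · refine (ae_map_iff hG.aemeasurable measurableSet_Icc).2 ?_
    exact Eventually.of_forall fun x => ⟨measureReal_nonneg, measureReal_le_one⟩
  · refine (mem_ae_map_iff hG.aemeasurable ?_).2 ?_
    · refine measurableSet_eq_fun (Monotone.measurable fun a b hab => ?_) measurable_id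
      exact measureReal_mono (Iic_subset_Iic.2 hab)
    filter_upwards [Measure.ae_ae_of_ae_prod hae] with x hx
    change (m.map G).real (Iic (G x)) = G x
    rw [measureReal_def, Measure.map_apply hG measurableSet_Iic]
    change m.real {y | G y ≤ G x} = m.real {y | r y x}
    refine le_antisymm ?_ (measureReal_mono fun y hy => hmono y x hy)
    refine ENNReal.toReal_mono (measure_ne_top _ _) (measure_mono_ae ?_)
    have hne : ∀ᵐ y ∂m, G y ≠ G x := by
      rw [ae_iff]; simp only [ne_eq, not_not]; exact hatom (G x)
    filter_upwards [hx, hne] with y hy hy' hle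
    rcases hy with h | h
    · exact absurd (le_antisymm hle (hmono _ _ h)) hy'
    · exact h

end RandomOrder

section Segments

variable {T : Type*} [MetricSpace T]

theorem mem_geoSeg {x y z : T} : z ∈ geoSeg x y ↔ dist x z + dist z y = dist x y := Iff.rfl

theorem left_mem_geoSeg (x y : T) : x ∈ geoSeg x y := by simp [mem_geoSeg]

theorem right_mem_geoSeg (x y : T) : y ∈ geoSeg x y := by simp [mem_geoSeg]

theorem geoSeg_comm (x y : T) : geoSeg x y = geoSeg y x := by
  ext z
  rw [mem_geoSeg, mem_geoSeg, dist_comm x y, dist_comm x z, dist_comm z y, add_comm]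

theorem geoSeg_subset_of_mem {x y z : T} (hz : z ∈ geoSeg x y) : geoSeg x z ⊆ geoSeg x y := by
  intro w hw
  rw [mem_geoSeg] at *
  linarith [dist_triangle w z y, dist_triangle x w y]

theorem geoSeg_subset_of_mem' {x y z : T} (hz : z ∈ geoSeg x y) : geoSeg z y ⊆ geoSeg x y := by
  rw [geoSeg_comm z y, geoSeg_comm x y] at *
  exact geoSeg_subset_of_mem hz

theorem eq_of_mem_geoSeg_of_mem_geoSeg {x y z : T} (hy : y ∈ geoSeg x z) (hz : z ∈ geoSeg x y) :
    y = z := by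
  rw [mem_geoSeg] at *
  rw [← dist_le_zero]
  linarith [dist_comm y z]

theorem isClosed_geoSeg (x y : T) : IsClosed (geoSeg x y) :=
  isClosed_eq (by fun_prop) (by fun_prop)

namespace IsRTree

theorem dist_eq_abs (h : IsRTree T) {x y a b : T} (ha : a ∈ geoSeg x y) (hb : b ∈ geoSeg x y) :
    dist a b = |dist x a - dist x b| := by
  obtain ⟨γ, h0, h1, hd, him⟩ := h.geodesic x y
  have h00 : (0:ℝ) ∈ Icc 0 (dist x y) := ⟨le_rfl, dist_nonneg⟩
  rw [← him] at ha hb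
  obtain ⟨s, hs, rfl⟩ := ha
  obtain ⟨t, ht, rfl⟩ := hb
  rw [hd s hs t ht, ← h0, hd 0 h00 s hs, hd 0 h00 t ht]
  simp [abs_of_nonneg hs.1, abs_of_nonneg ht.1]

theorem mem_geoSeg_left_of_dist_le (h : IsRTree T) {x y a b : T} (ha : a ∈ geoSeg x y)
    (hb : b ∈ geoSeg x y) (hab : dist x a ≤ dist x b) : a ∈ geoSeg x b := by
  rw [mem_geoSeg, h.dist_eq_abs ha hb, abs_of_nonpos (by linarith)]
  linarith

theorem mem_geoSeg_right_of_dist_le (h : IsRTree T) {x y a b : T} (ha : a ∈ geoSeg x y)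
    (hb : b ∈ geoSeg x y) (hab : dist x a ≤ dist x b) : b ∈ geoSeg a y := by
  have := h.dist_eq_abs ha hb
  rw [abs_of_nonpos (by linarith)] at this
  rw [mem_geoSeg] at *
  linarith

theorem eq_of_dist_eq (h : IsRTree T) {x y a b : T} (ha : a ∈ geoSeg x y)
    (hb : b ∈ geoSeg x y) (hab : dist x a = dist x b) : a = b := by
  rw [← dist_eq_zero, h.dist_eq_abs ha hb, hab, sub_self, abs_zero]

theorem isPreconnected_geoSeg (h : IsRTree T) (x y : T) : IsPreconnected (geoSeg x y) := by
  obtain ⟨γ, h0, h1, hd, him⟩ := h.geodesic x y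
  rw [← him]
  refine isPreconnected_Icc.image γ (LipschitzOnWith.continuousOn (K := 1) ?_)
  exact LipschitzOnWith.of_dist_le_mul fun s hs t ht => by simp [hd s hs t ht, Real.dist_eq]

/-- Three points of an `ℝ`-tree have a median. -/
theorem exists_median (h : IsRTree T) (x y z : T) :
    ∃ w, w ∈ geoSeg x y ∧ w ∈ geoSeg y z ∧ w ∈ geoSeg x z := by
  obtain ⟨γ, h0, h1, hd, him⟩ := h.geodesic x y
  have hγ : ContinuousOn γ (Icc 0 (dist x y)) :=
    LipschitzOnWith.continuousOn (K := 1) (LipschitzOnWith.of_dist_le_mul fun s hs t ht => by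
      simp [hd s hs t ht, Real.dist_eq])
  have hclosed : IsClosed (Icc 0 (dist x y) ∩ γ ⁻¹' geoSeg y z) :=
    hγ.preimage_isClosed_of_isClosed isClosed_Icc (isClosed_geoSeg y z)
  have hcomp : IsCompact (Icc 0 (dist x y) ∩ γ ⁻¹' geoSeg y z) :=
    isCompact_Icc.of_isClosed_subset hclosed inter_subset_left
  obtain ⟨s₀, ⟨hs₀, hws⟩, hmin⟩ := hcomp.exists_isLeast
    ⟨dist x y, ⟨dist_nonneg, le_rfl⟩, by simp [h1, left_mem_geoSeg]⟩
  have hws : γ s₀ ∈ geoSeg y z := hws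
  obtain ⟨δ, g0, g1, gd, gim⟩ := h.geodesic (γ s₀) z
  have hw : γ s₀ ∈ geoSeg x y := him ▸ mem_image_of_mem γ hs₀
  refine ⟨γ s₀, hw, hws, ?_⟩
  set D := dist (γ s₀) z
  have hD : 0 ≤ D := dist_nonneg
  set L := s₀ + D with hL
  rcases (add_nonneg hs₀.1 hD).eq_or_lt with hL0 | hLpos
  · have : s₀ = 0 := by linarith [hs₀.1]
    rw [this, h0]
    exact left_mem_geoSeg x z
  have hin1 : ∀ s, 0 ≤ s → s ≤ s₀ → s ∈ Icc 0 (dist x y) := fun s h1 h2 => ⟨h1, h2.trans hs₀.2⟩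
  have hin2 : ∀ s, s₀ ≤ s → s ≤ L → s - s₀ ∈ Icc 0 D := fun s h1 h2 => ⟨by linarith, by linarith⟩
  have hDin : (0:ℝ) ∈ Icc 0 D := ⟨le_rfl, hD⟩
  set f : ℝ → T := fun s => if s ≤ s₀ then γ s else δ (s - s₀) with hf
  have f1 : ∀ s, s ≤ s₀ → f s = γ s := fun s hs => if_pos hs
  have f2 : ∀ s, s₀ ≤ s → f s = δ (s - s₀) := by
    intro s hs
    rcases hs.eq_or_lt with rfl | hs
    · simp [hf, g0]
    · exact if_neg (not_le.2 hs)
  have hlip : ∀ s ∈ Icc 0 L, ∀ t ∈ Icc 0 L, s ≤ t → dist (f s) (f t) ≤ |s - t| := by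
    intro s hs t ht hst
    rcases le_total t s₀ with h3 | h3
    · rw [f1 s (hst.trans h3), f1 t h3,
        hd s (hin1 s hs.1 (hst.trans h3)) t (hin1 t ht.1 h3)]
    rcases le_total s₀ s with h4 | h4
    · rw [f2 s h4, f2 t h3, gd _ (hin2 s h4 hs.2) _ (hin2 t h3 ht.2)]
      simp
    · rw [f1 s h4, f2 t h3]
      have e1 := hd s (hin1 s hs.1 h4) s₀ hs₀
      have e2 := gd 0 hDin _ (hin2 t h3 ht.2)
      rw [g0] at e2
      rw [abs_of_nonpos (by linarith)] at *
      linarith [dist_triangle (γ s) (γ s₀) (δ (t - s₀))]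
  have hinj : ∀ s ∈ Icc 0 L, ∀ t ∈ Icc 0 L, s ≤ t → f s = f t → s = t := by
    intro s hs t ht hst heq
    rcases le_total t s₀ with h3 | h3
    · rw [f1 s (hst.trans h3), f1 t h3, ← dist_eq_zero,
        hd s (hin1 s hs.1 (hst.trans h3)) t (hin1 t ht.1 h3), abs_eq_zero] at heq
      linarith
    rcases le_or_gt s₀ s with h4 | h4
    · rw [f2 s h4, f2 t h3, ← dist_eq_zero, gd _ (hin2 s h4 hs.2) _ (hin2 t h3 ht.2),
        abs_eq_zero] at heq
      linarith
    · rw [f1 s h4.le, f2 t h3] at heq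
      have : δ (t - s₀) ∈ geoSeg (γ s₀) z := gim ▸ mem_image_of_mem δ (hin2 t h3 ht.2)
      have := geoSeg_subset_of_mem' hws this
      rw [← heq] at this
      exact absurd (hmin ⟨hin1 s hs.1 h4.le, this⟩) (not_le.2 h4)
  have hscale : ∀ s ∈ Icc (0:ℝ) 1, L * s ∈ Icc 0 L := fun s hs =>
    ⟨mul_nonneg hLpos.le hs.1, by nlinarith [hs.2]⟩
  have hfc : ContinuousOn f (Icc 0 L) :=
    LipschitzOnWith.continuousOn (K := 1) (LipschitzOnWith.of_dist_le_mul fun s hs t ht => by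
      rw [NNReal.coe_one, one_mul, Real.dist_eq]
      rcases le_total s t with h3 | h3
      · exact hlip s hs t ht h3
      · rw [dist_comm, abs_sub_comm]
        exact hlip t ht s hs h3)
  have himg := h.loopless x z (fun s => f (L * s)) (hfc.comp (by fun_prop) hscale)
    (by
      intro s hs t ht hst
      refine mul_left_cancel₀ hLpos.ne' ?_
      rcases le_total (L * s) (L * t) with h3 | h3
      · exact hinj _ (hscale s hs) _ (hscale t ht) h3 hst
      · exact (hinj _ (hscale t ht) _ (hscale s hs) h3 hst.symm).symm)
    (by simp only [mul_zero]; rw [f1 0 hs₀.1, h0])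
    (by simp only [mul_one]; rw [f2 L (by linarith), hL, add_sub_cancel_left, g1])
  rw [← himg]
  refine ⟨s₀ / L, ⟨div_nonneg hs₀.1 hLpos.le, (div_le_one hLpos).2 (by linarith)⟩, ?_⟩
  simp only
  rw [mul_div_cancel₀ _ hLpos.ne', f1 s₀ le_rfl]

theorem geoSeg_subset_union (h : IsRTree T) (x y z : T) :
    geoSeg x z ⊆ geoSeg x y ∪ geoSeg y z := by
  intro b hb
  obtain ⟨w, h1, h2, h3⟩ := h.exists_median x y z
  rcases le_total (dist x b) (dist x w) with hle | hle
  · exact Or.inl (geoSeg_subset_of_mem h1 (h.mem_geoSeg_left_of_dist_le hb h3 hle))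
  · exact Or.inr (geoSeg_subset_of_mem' h2 (h.mem_geoSeg_right_of_dist_le h3 hb hle))

theorem notMem_geoSeg_of_dist_lt {b x y : T} (hxy : dist x y < dist x b) : b ∉ geoSeg x y := by
  intro hb
  rw [mem_geoSeg] at hb
  linarith [dist_nonneg (x := b) (y := y)]

theorem connectedComponentIn_eq_iff (h : IsRTree T) {b y z : T} (hy : y ≠ b) (hz : z ≠ b) :
    connectedComponentIn ({b}ᶜ) y = connectedComponentIn ({b}ᶜ) z ↔ b ∉ geoSeg y z := by
  constructor
  · intro heq hb
    set C : Set T := connectedComponentIn ({b}ᶜ) y with hC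
    have hsub : C ⊆ {b}ᶜ := connectedComponentIn_subset _ _
    have hyC : y ∈ C := mem_connectedComponentIn hy
    have hzC : z ∈ C := heq ▸ mem_connectedComponentIn hz
    have hpre : IsPreconnected C := isPreconnected_connectedComponentIn
    set U : Set T := {w | w ≠ b ∧ b ∉ geoSeg y w}
    set V : Set T := {w | w ≠ b ∧ b ∈ geoSeg y w}
    have hnear : ∀ w v, w ≠ b → dist v w < dist w b → v ≠ b ∧ b ∉ geoSeg w v := by
      intro w v hw hv
      refine ⟨?_, notMem_geoSeg_of_dist_lt (by rwa [dist_comm])⟩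
      rintro rfl
      rw [dist_comm] at hv
      exact lt_irrefl _ hv
    have hU : IsOpen U := by
      rw [Metric.isOpen_iff]
      rintro w ⟨hw, hbw⟩
      refine ⟨dist w b, dist_pos.2 hw, fun v hv => ?_⟩
      obtain ⟨h1, h2⟩ := hnear w v hw hv
      exact ⟨h1, fun h3 => (h.geoSeg_subset_union y w v h3).elim hbw h2⟩
    have hV : IsOpen V := by
      rw [Metric.isOpen_iff]
      rintro w ⟨hw, hbw⟩
      refine ⟨dist w b, dist_pos.2 hw, fun v hv => ?_⟩
      obtain ⟨h1, h2⟩ := hnear w v hw hv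
      exact ⟨h1, (h.geoSeg_subset_union y v w hbw).resolve_right (by rwa [geoSeg_comm])⟩
    obtain ⟨w, -, hw1, hw2⟩ := hpre U V hU hV (fun w hw => by
        by_cases hb : b ∈ geoSeg y w
        · exact Or.inr ⟨hsub hw, hb⟩
        · exact Or.inl ⟨hsub hw, hb⟩)
      ⟨y, hyC, hy, notMem_geoSeg_of_dist_lt (by rw [dist_self]; exact dist_pos.2 hy)⟩ ⟨z, hzC, hz, hb⟩
    exact hw1.2 hw2.2
  · intro hb
    refine connectedComponentIn_eq ?_
    refine (h.isPreconnected_geoSeg y z).subset_connectedComponentIn (left_mem_geoSeg y z) ?_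
      (right_mem_geoSeg y z)
    exact fun w hw hwb => hb (hwb ▸ hw)

end IsRTree

end Segments

namespace PlaneRTree

variable {T : Type*} [MetricSpace T] (P : PlaneRTree T)

theorem u_eq_u_iff {b y z : T} (hy : y ≠ b) (hz : z ≠ b) :
    P.u b y = P.u b z ↔ b ∉ geoSeg y z :=
  (P.u_eq_iff b y z hy hz).trans (P.tree.connectedComponentIn_eq_iff hy hz)

theorem cca_mem_left (x y : T) : P.cca x y ∈ geoSeg P.root x := (P.cca_mem x y).1

theorem cca_mem_right (x y : T) : P.cca x y ∈ geoSeg P.root y := (P.cca_mem x y).2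

/-- The closest common ancestor of `x` and `y` is the median of the root, `x` and `y`. -/
theorem cca_eq_iff {x y b : T} : P.cca x y = b ↔
    b ∈ geoSeg P.root x ∧ b ∈ geoSeg P.root y ∧ b ∈ geoSeg x y := by
  have key : ∀ c, c ∈ geoSeg P.root x → c ∈ geoSeg P.root y → c ∈ geoSeg x y →
      P.cca x y = c := by
    intro c h1 h2 h3
    refine P.tree.eq_of_dist_eq (P.cca_mem_left x y) h1
      (le_antisymm ?_ (P.cca_max x y c ⟨h1, h2⟩))
    have h4 := P.cca_mem_left x y
    have h5 := P.cca_mem_right x y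
    rw [mem_geoSeg] at *
    linarith [dist_triangle x (P.cca x y) y, dist_comm x (P.cca x y), dist_comm x c]
  refine ⟨?_, fun ⟨h1, h2, h3⟩ => key b h1 h2 h3⟩
  rintro rfl
  refine ⟨P.cca_mem_left x y, P.cca_mem_right x y, ?_⟩
  obtain ⟨w, h1, h2, h3⟩ := P.tree.exists_median P.root x y
  rwa [key w h1 h3 h2]

theorem cca_comm (x y : T) : P.cca x y = P.cca y x := by
  obtain ⟨h1, h2, h3⟩ := P.cca_eq_iff.1 (rfl : P.cca y x = _)
  exact P.cca_eq_iff.2 ⟨h2, h1, geoSeg_comm y x ▸ h3⟩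

theorem mem_geoSeg_cca {x y c : T} (hx : c ∈ geoSeg P.root x) (hy : c ∈ geoSeg P.root y) :
    c ∈ geoSeg P.root (P.cca x y) :=
  P.tree.mem_geoSeg_left_of_dist_le hx (P.cca_mem_left x y) (P.cca_max x y c ⟨hx, hy⟩)

theorem ang_of_ne {b : T} {β : T × ℝ} (h : β.1 ≠ b) : P.ang b β = P.u b β.1 := if_neg h.symm

theorem ang_of_eq {b : T} {β : T × ℝ} (h : β.1 = b) : P.ang b β = β.2 := if_pos h.symm

theorem ang_eq_of_mem_geoSeg_cca {α β : T × ℝ} {c : T}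
    (hc : c ∈ geoSeg P.root (P.cca α.1 β.1)) (hne : c ≠ P.cca α.1 β.1) :
    P.ang c α = P.ang c β := by
  have hα : α.1 ≠ c := fun h => hne
    (eq_of_mem_geoSeg_of_mem_geoSeg hc (h ▸ P.cca_mem_left α.1 β.1))
  have hβ : β.1 ≠ c := fun h => hne
    (eq_of_mem_geoSeg_of_mem_geoSeg hc (h ▸ P.cca_mem_right α.1 β.1))
  rw [P.ang_of_ne hα, P.ang_of_ne hβ, P.u_eq_u_iff hα hβ]
  exact fun h => hne (P.cca_eq_iff.2 ⟨geoSeg_subset_of_mem (P.cca_mem_left _ _) hc,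
    geoSeg_subset_of_mem (P.cca_mem_right _ _) hc, h⟩).symm

theorem leftOf_of_ang_lt {α β : T × ℝ} {c : T} (hα : c ∈ geoSeg P.root α.1)
    (hβ : c ∈ geoSeg P.root β.1) (h : P.ang c α < P.ang c β) : P.leftOf α β := by
  have : c = P.cca α.1 β.1 := by
    by_contra hne
    exact h.ne (P.ang_eq_of_mem_geoSeg_cca (P.mem_geoSeg_cca hα hβ) hne)
  rw [leftOf, ← this]
  exact h

theorem not_leftOf_of_leftOf {α β : T × ℝ} (h : P.leftOf α β) : ¬ P.leftOf β α := by
  rw [leftOf, P.cca_comm]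
  exact not_lt.2 (le_of_lt h)

theorem leftOf_trans {α β γ : T × ℝ} (h1 : P.leftOf α β) (h2 : P.leftOf β γ) :
    P.leftOf α γ := by
  have hc1 := P.cca_mem_right α.1 β.1
  have hc2 := P.cca_mem_left β.1 γ.1
  rcases le_total (dist P.root (P.cca α.1 β.1)) (dist P.root (P.cca β.1 γ.1)) with hle | hle
  · have hmem := P.tree.mem_geoSeg_left_of_dist_le hc1 hc2 hle
    refine P.leftOf_of_ang_lt (P.cca_mem_left α.1 β.1)
      (geoSeg_subset_of_mem (P.cca_mem_right β.1 γ.1) hmem) ?_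
    by_cases heq : P.cca α.1 β.1 = P.cca β.1 γ.1
    · refine lt_trans h1 ?_
      rw [heq]
      exact h2
    · rw [← P.ang_eq_of_mem_geoSeg_cca hmem heq]
      exact h1
  · have hmem := P.tree.mem_geoSeg_left_of_dist_le hc2 hc1 hle
    refine P.leftOf_of_ang_lt (geoSeg_subset_of_mem (P.cca_mem_left α.1 β.1) hmem)
      (P.cca_mem_right β.1 γ.1) ?_
    by_cases heq : P.cca β.1 γ.1 = P.cca α.1 β.1
    · refine lt_trans ?_ h2
      rw [heq]
      exact h1
    · rw [P.ang_eq_of_mem_geoSeg_cca hmem heq]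
      exact h2

/-- The points seen from some descendant under an angle other than `1/2`. -/
def unbalancedPoints : Set T := {b | ∃ y, b ∈ geoSeg P.root y ∧ y ≠ b ∧ P.u b y ≠ 1 / 2}

theorem isOpen_sameComponent {b y : T} (hy : y ≠ b) : IsOpen {w | w ≠ b ∧ P.u b w = P.u b y} := by
  rw [Metric.isOpen_iff]
  rintro w ⟨hw, hwy⟩
  refine ⟨dist w b, dist_pos.2 hw, fun v hv => ?_⟩
  have hv' : dist v w < dist w b := hv
  have hvb : v ≠ b := by
    rintro rfl
    rw [dist_comm] at hv'
    exact lt_irrefl _ hv'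
  refine ⟨hvb, ?_⟩
  rw [← hwy, P.u_eq_u_iff hvb hw, geoSeg_comm]
  exact IsRTree.notMem_geoSeg_of_dist_lt (by rwa [dist_comm])

theorem exists_third_component {b : T} (hb : b ∈ P.unbalancedPoints) (hroot : P.root ≠ b) :
    ∃ y z, y ≠ b ∧ z ≠ b ∧ P.u b y ≠ 0 ∧ P.u b z ≠ 0 ∧ P.u b y ≠ P.u b z := by
  obtain ⟨y, hby, hyb, hu⟩ := hb
  have hu0 : P.u b y ≠ 0 := by
    rw [← P.u_root b]
    exact fun h => (P.u_eq_u_iff hyb hroot).1 h (geoSeg_comm P.root y ▸ hby)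
  refine ⟨y, ?_⟩
  by_contra! hcon
  have hcomps : comps b =
      {connectedComponentIn ({b}ᶜ) P.root, connectedComponentIn ({b}ᶜ) y} := by
    ext C
    constructor
    · rintro ⟨z, hz, rfl⟩
      by_cases hz0 : P.u b z = 0
      · left
        rwa [← P.u_eq_iff b z P.root hz hroot, P.u_root]
      · right
        exact (P.u_eq_iff b z y hz hyb).1 (hcon z hyb hz hu0 hz0).symm
    · rintro (rfl | rfl)
      · exact ⟨P.root, hroot, rfl⟩
      · exact ⟨y, hyb, rfl⟩
  have hcard : (comps b).ncard = 2 := by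
    rw [hcomps]
    refine ncard_pair fun h => hu0 ?_
    rw [← P.u_root b]
    exact (P.u_eq_iff b y P.root hyb hroot).2 h.symm
  rcases P.balanced b y hcard with h | h
  · exact hu0 h
  · exact hu h

theorem countable_unbalancedPoints : P.unbalancedPoints.Countable := by
  have := P.sep
  obtain ⟨D, hD, hdense⟩ := TopologicalSpace.exists_countable_dense T
  refine ((hD.image2 hD P.cca).insert P.root).mono fun b hb => ?_
  by_cases hroot : P.root = b
  · exact Or.inl hroot.symm
  right
  obtain ⟨y, z, hy, hz, hy0, hz0, hyz⟩ := P.exists_third_component hb hroot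
  obtain ⟨q, ⟨hq, hqy⟩, hqD⟩ := hdense.inter_open_nonempty _ (P.isOpen_sameComponent hy) ⟨y, hy, rfl⟩
  obtain ⟨r, ⟨hr, hrz⟩, hrD⟩ := hdense.inter_open_nonempty _ (P.isOpen_sameComponent hz) ⟨z, hz, rfl⟩
  refine ⟨q, hqD, r, hrD, P.cca_eq_iff.2 ⟨?_, ?_, ?_⟩⟩
  · by_contra h
    exact hy0 (by rw [← hqy, ← P.u_root b, (P.u_eq_u_iff hroot hq).2 h])
  · by_contra h
    exact hz0 (by rw [← hrz, ← P.u_root b, (P.u_eq_u_iff hroot hr).2 h])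
  · by_contra h
    exact hyz (by rw [← hqy, ← hrz, (P.u_eq_u_iff hq hr).2 h])

theorem leftOf_iff {α β : T × ℝ} : P.leftOf α β ↔
    (α.1 = β.1 ∧ α.2 < β.2) ∨
    (α.1 ≠ β.1 ∧ α.1 ∈ geoSeg P.root β.1 ∧ α.1 ∉ P.unbalancedPoints ∧ α.2 < 1 / 2) ∨
    (α.1 ≠ β.1 ∧ β.1 ∈ geoSeg P.root α.1 ∧ β.1 ∉ P.unbalancedPoints ∧ 1 / 2 < β.2) ∨
    ∃ b ∈ P.unbalancedPoints,
      (b ∈ geoSeg P.root α.1 ∧ b ∈ geoSeg P.root β.1) ∧ P.ang b α < P.ang b β := by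
  have hhalf : ∀ {b : T} {γ : T × ℝ}, b ∉ P.unbalancedPoints → b ∈ geoSeg P.root γ.1 →
      γ.1 ≠ b → P.ang b γ = 1 / 2 := by
    intro b γ hb hγ hne
    rw [P.ang_of_ne hne]
    by_contra h
    exact hb ⟨γ.1, hγ, hne, h⟩
  constructor
  · intro h
    have hα := P.cca_mem_left α.1 β.1
    have hβ := P.cca_mem_right α.1 β.1
    rw [leftOf] at h
    generalize P.cca α.1 β.1 = c at h hα hβ
    by_cases hc : c ∈ P.unbalancedPoints
    · exact Or.inr (Or.inr (Or.inr ⟨c, hc, ⟨hα, hβ⟩, h⟩))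
    by_cases h1 : α.1 = c <;> by_cases h2 : β.1 = c
    · rw [P.ang_of_eq h1, P.ang_of_eq h2] at h
      exact Or.inl ⟨h1.trans h2.symm, h⟩
    · rw [P.ang_of_eq h1, hhalf hc hβ h2] at h
      refine Or.inr (Or.inl ⟨fun h3 => h2 (h3 ▸ h1), ?_, ?_, h⟩) <;> rwa [h1]
    · rw [P.ang_of_eq h2, hhalf hc hα h1] at h
      refine Or.inr (Or.inr (Or.inl ⟨fun h3 => h1 (h3 ▸ h2), ?_, ?_, h⟩)) <;> rwa [h2]
    · rw [hhalf hc hα h1, hhalf hc hβ h2] at h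
      exact absurd h (lt_irrefl _)
  · rintro (⟨h1, h2⟩ | ⟨h1, h2, h3, h4⟩ | ⟨h1, h2, h3, h4⟩ | ⟨b, -, ⟨h1, h2⟩, h3⟩)
    · refine P.leftOf_of_ang_lt (right_mem_geoSeg _ _) (h1 ▸ right_mem_geoSeg _ _) ?_
      rwa [P.ang_of_eq rfl, P.ang_of_eq h1.symm]
    · refine P.leftOf_of_ang_lt (right_mem_geoSeg _ _) h2 ?_
      rwa [P.ang_of_eq rfl, hhalf h3 h2 h1.symm]
    · refine P.leftOf_of_ang_lt h2 (right_mem_geoSeg _ _) ?_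
      rwa [P.ang_of_eq rfl, hhalf h3 h2 h1]
    · exact P.leftOf_of_ang_lt h1 h2 h3

theorem frontOf_or_frontOf_of_not_leftOf {α β : T × ℝ} (h1 : ¬ P.leftOf α β)
    (h2 : ¬ P.leftOf β α) : P.frontOf α β ∨ P.frontOf β α := by
  have heq : P.ang (P.cca α.1 β.1) α = P.ang (P.cca α.1 β.1) β := by
    rw [leftOf, P.cca_comm] at h2
    exact le_antisymm (not_lt.1 h2) (not_lt.1 h1)
  obtain ⟨hα, hβ, hαβ⟩ := P.cca_eq_iff.1 (rfl : P.cca α.1 β.1 = _)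
  generalize P.cca α.1 β.1 = c at heq hα hβ hαβ
  by_cases e1 : α.1 = c
  · left
    subst e1
    exact ⟨hβ, heq.symm.trans (P.ang_of_eq rfl)⟩
  by_cases e2 : β.1 = c
  · right
    subst e2
    exact ⟨hα, heq.trans (P.ang_of_eq rfl)⟩
  rw [P.ang_of_ne e1, P.ang_of_ne e2, P.u_eq_u_iff e1 e2] at heq
  exact absurd hαβ heq

theorem frontOf_symm_of_mem_geoSeg {α β : T × ℝ} (h : P.frontOf β α)
    (hαβ : α.1 ∈ geoSeg P.root β.1) : P.frontOf α β := by
  have e : α.1 = β.1 := eq_of_mem_geoSeg_of_mem_geoSeg hαβ h.1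
  refine ⟨hαβ, ?_⟩
  rw [P.ang_of_eq e.symm, ← h.2, P.ang_of_eq e]

/-- The elements behind a given `β` have their angle in a countable set. -/
theorem countable_angles_of_frontOf (β : T × ℝ) :
    {v : ℝ | ∃ x, P.frontOf (x, v) β}.Countable := by
  refine (((P.countable_unbalancedPoints.image fun b => P.u b β.1).insert (1 / 2)).insert
    β.2).mono ?_
  rintro v ⟨x, hx, hv : P.ang x β = v⟩
  by_cases e : β.1 = x
  · left
    rw [← hv, P.ang_of_eq e]
  rw [P.ang_of_ne e] at hv
  by_cases hb : x ∈ P.unbalancedPoints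
  · exact Or.inr (Or.inr ⟨x, hb, hv⟩)
  · right; left
    rw [← hv]
    by_contra h
    exact hb ⟨β.1, hx, e, h⟩

variable [MeasurableSpace T]

instance (p : Measure T) [IsProbabilityMeasure p] : IsProbabilityMeasure (pL p) := by
  have : IsProbabilityMeasure (volume.restrict (Icc (0:ℝ) 1)) := ⟨by simp⟩
  rw [pL]
  infer_instance

theorem pL_frontOf_eq_zero (p : Measure T) [IsProbabilityMeasure p] (β : T × ℝ) :
    pL p {α | P.frontOf α β} = 0 := by
  refine measure_mono_null
    (t := univ ×ˢ {v : ℝ | ∃ x, P.frontOf (x, v) β}) (fun α hα => ⟨mem_univ _, α.1, hα⟩) ?_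
  rw [pL, Measure.prod_prod, (P.countable_angles_of_frontOf β).measure_zero, mul_zero]

variable [BorelSpace T]

theorem measurable_ang (b : T) : Measurable (P.ang b) := by
  classical
  have := P.sep
  have := UniformSpace.secondCountable_of_separable T
  have hu : ∀ a : ℝ, IsOpen {w | w ≠ b ∧ a < P.u b w} := by
    intro a
    have : {w | w ≠ b ∧ a < P.u b w} =
        ⋃ y ∈ {y | y ≠ b ∧ a < P.u b y}, {w | w ≠ b ∧ P.u b w = P.u b y} := by
      ext w
      simp only [mem_ofPred_eq, mem_iUnion, exists_prop]
      constructor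
      · rintro ⟨h1, h2⟩
        exact ⟨w, ⟨h1, h2⟩, h1, rfl⟩
      · rintro ⟨y, ⟨-, h1⟩, h2, h3⟩
        exact ⟨h2, h3 ▸ h1⟩
    rw [this]
    exact isOpen_biUnion fun y hy => P.isOpen_sameComponent hy.1
  have hmeas : Measurable (P.u b) := by
    refine measurable_of_Ioi fun a => ?_
    have : P.u b ⁻¹' Ioi a =
        {w | w ≠ b ∧ a < P.u b w} ∪ {w | w = b ∧ a < P.u b b} := by
      ext w
      simp only [mem_preimage, mem_Ioi, mem_union, mem_ofPred_eq]
      by_cases h : w = b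
      · simp [h]
      · simp [h]
    rw [this]
    refine (hu a).measurableSet.union ?_
    exact (measurableSet_singleton b).inter (MeasurableSet.const _)
  exact Measurable.ite (measurableSet_eq_fun measurable_const measurable_fst) measurable_snd
    (hmeas.comp measurable_fst)

theorem measurableSet_mem_geoSeg :
    MeasurableSet {q : T × T | q.1 ∈ geoSeg P.root q.2} := by
  have := P.sep
  have := UniformSpace.secondCountable_of_separable T
  exact measurableSet_eq_fun (by fun_prop) (by fun_prop)

theorem measurableSet_leftOf :
    MeasurableSet {q : (T × ℝ) × (T × ℝ) | P.leftOf q.1 q.2} := by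
  have := P.sep
  have := UniformSpace.secondCountable_of_separable T
  have hB := P.countable_unbalancedPoints.measurableSet
  have heq : MeasurableSet {q : (T × ℝ) × (T × ℝ) | q.1.1 = q.2.1} :=
    measurableSet_eq_fun (by fun_prop) (by fun_prop)
  have hfst : Measurable fun q : (T × ℝ) × (T × ℝ) => (q.1.1, q.2.1) := by fun_prop
  have hsnd : Measurable fun q : (T × ℝ) × (T × ℝ) => (q.2.1, q.1.1) := by fun_prop
  have h1 := hfst P.measurableSet_mem_geoSeg
  have h2 := hsnd P.measurableSet_mem_geoSeg
  have hB1 : MeasurableSet {q : (T × ℝ) × (T × ℝ) | q.1.1 ∈ P.unbalancedPoints} :=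
    (show Measurable fun q : (T × ℝ) × (T × ℝ) => q.1.1 by fun_prop) hB
  have hB2 : MeasurableSet {q : (T × ℝ) × (T × ℝ) | q.2.1 ∈ P.unbalancedPoints} :=
    (show Measurable fun q : (T × ℝ) × (T × ℝ) => q.2.1 by fun_prop) hB
  have hlt : MeasurableSet {q : (T × ℝ) × (T × ℝ) | q.1.2 < q.2.2} :=
    measurableSet_lt (by fun_prop) (by fun_prop)
  have hlt1 : MeasurableSet {q : (T × ℝ) × (T × ℝ) | q.1.2 < 1 / 2} :=
    measurableSet_lt (by fun_prop) (by fun_prop)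
  have hlt2 : MeasurableSet {q : (T × ℝ) × (T × ℝ) | 1 / 2 < q.2.2} :=
    measurableSet_lt (by fun_prop) (by fun_prop)
  simp_rw [P.leftOf_iff]
  refine (heq.inter hlt).union ((heq.compl.inter (h1.inter (hB1.compl.inter hlt1))).union
    ((heq.compl.inter (h2.inter (hB2.compl.inter hlt2))).union ?_))
  have : {q : (T × ℝ) × (T × ℝ) | ∃ b ∈ P.unbalancedPoints,
      (b ∈ geoSeg P.root q.1.1 ∧ b ∈ geoSeg P.root q.2.1) ∧ P.ang b q.1 < P.ang b q.2} =
      ⋃ b ∈ P.unbalancedPoints, {q : (T × ℝ) × (T × ℝ) |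
        (b ∈ geoSeg P.root q.1.1 ∧ b ∈ geoSeg P.root q.2.1) ∧ P.ang b q.1 < P.ang b q.2} := by
    ext q
    simp only [mem_ofPred_eq, mem_iUnion, exists_prop]
  refine (congrArg MeasurableSet this).mpr ?_
  refine MeasurableSet.biUnion P.countable_unbalancedPoints fun b _ => ?_
  refine MeasurableSet.inter (MeasurableSet.inter ?_ ?_) ?_
  · exact measurableSet_eq_fun (by fun_prop) (by fun_prop)
  · exact measurableSet_eq_fun (by fun_prop) (by fun_prop)
  · exact measurableSet_lt ((P.measurable_ang b).comp measurable_fst)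
      ((P.measurable_ang b).comp measurable_snd)

theorem ae_leftOf_or_leftOf (p : Measure T) [IsProbabilityMeasure p] :
    ∀ᵐ q ∂((pL p).prod (pL p)), P.leftOf q.1 q.2 ∨ P.leftOf q.2 q.1 := by
  have hL := P.measurableSet_leftOf
  have hL' : MeasurableSet {q : (T × ℝ) × (T × ℝ) | P.leftOf q.2 q.1} := measurable_swap hL
  have hbase : Measurable fun q : (T × ℝ) × (T × ℝ) => (q.2.1, q.1.1) := by fun_prop
  set N : Set ((T × ℝ) × (T × ℝ)) :=
    {q | (¬ P.leftOf q.1 q.2 ∧ ¬ P.leftOf q.2 q.1) ∧ q.2.1 ∈ geoSeg P.root q.1.1} with hN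
  have hNm : MeasurableSet N := (hL.compl.inter hL'.compl).inter (hbase P.measurableSet_mem_geoSeg)
  have hN0 : (pL p).prod (pL p) N = 0 := by
    rw [Measure.measure_prod_null hNm]
    refine Eventually.of_forall fun β => measure_mono_null ?_ (P.pL_frontOf_eq_zero p β)
    rintro α ⟨⟨h1, h2⟩, h3⟩
    exact (P.frontOf_or_frontOf_of_not_leftOf h2 h1).elim id
      fun h => P.frontOf_symm_of_mem_geoSeg h h3
  have hN0' : (pL p).prod (pL p) (Prod.swap ⁻¹' N) = 0 :=
    (Measure.measurePreserving_swap (μ := pL p) (ν := pL p)).measure_preimage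
      hNm.nullMeasurableSet |>.trans hN0
  rw [ae_iff]
  refine measure_mono_null ?_ (measure_union_null hN0 hN0')
  rintro ⟨α, β⟩ h
  obtain ⟨h1, h2⟩ : ¬ P.leftOf α β ∧ ¬ P.leftOf β α := not_or.1 h
  rcases P.frontOf_or_frontOf_of_not_leftOf h1 h2 with h3 | h3
  · exact Or.inr ⟨⟨h2, h1⟩, h3.1⟩
  · exact Or.inl ⟨⟨h1, h2⟩, h3.1⟩

end PlaneRTree

/-- If `A` is a random variable with law `p_L`, then `p_↶(A)` is uniformly
distributed on `[0,1]`. -/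
theorem pleft_uniform {T : Type*} [MetricSpace T]
    [MeasurableSpace T] [BorelSpace T] (P : PlaneRTree T)
    (p : Measure T) [IsProbabilityMeasure p]
    {Ω : Type*} [MeasurableSpace Ω] (μ : Measure Ω) [IsProbabilityMeasure μ]
    (A : Ω → T × ℝ) (hA : Measurable A)
    (hlaw : Measure.map A μ = PlaneRTree.pL p) :
    Measure.map (fun ω => P.pleft p (A ω)) μ = volume.restrict (Icc (0:ℝ) 1) := by
  obtain ⟨hmeas, hunif⟩ := map_measureReal_below_eq_uniform (m := PlaneRTree.pL p) (r := P.leftOf)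
    P.measurableSet_leftOf (fun _ _ _ => P.leftOf_trans) (fun _ _ => P.not_leftOf_of_leftOf)
    (P.ae_leftOf_or_leftOf p)
  rw [← hunif, ← hlaw, Measure.map_map (hlaw ▸ hmeas) hA]
  rw [hlaw]
  rfl
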